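/- For the discrete-time Gaussian channel Y_i = √snr · X_i + N_i, i = 1, …, n, with Σ_{i=1}^n E[X_i^2] < ∞, the derivative of the mutual information satisfies d/dsnr I(Xⁿ; √snr · Xⁿ + Nⁿ) = (1/2) Σ_{i=1}^{n} mmse(i, snr), where mmse(i, snr) = E[(X_i − E[X_i | Yⁿ; snr])^2] is the noncausal MMSE at time i given the entire observation Yⁿ = (Y_1, …, Y_n). -/

import Mathlib

open MeasureTheory ProbabilityTheory Real Filter
open scoped ENNReal NNReal Topology

noncomputable section

open scoped Classical in
/-- Kullback–Leibler divergence `D(μ ‖ ν)` in nats, with values in `[0, ∞]`. -/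
def klDiv {α : Type*} [MeasurableSpace α] (μ ν : Measure α) : ℝ≥0∞ :=
  if μ ≪ ν ∧ Integrable (llr μ ν) μ then ENNReal.ofReal (∫ x, llr μ ν x ∂μ) else ⊤

/-- Mutual information `I(A; B)` in nats: the KL divergence of the joint law of `(A, B)`
from the product of its marginals. -/
def mutualInfo {Ω α β : Type*} [MeasurableSpace Ω] [MeasurableSpace α] [MeasurableSpace β]
    (μ : Measure Ω) (A : Ω → α) (B : Ω → β) : ℝ≥0∞ :=
  klDiv (μ.map fun ω => (A ω, B ω)) ((μ.map A).prod (μ.map B))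

/-- Output of the discrete-time Gaussian channel `Y_i = √snr · X_i + N_i`, `i = 1, …, n`. -/
def chOutN {Ω : Type*} {n : ℕ} (X N : Ω → Fin n → ℝ) (snr : ℝ) : Ω → Fin n → ℝ :=
  fun ω i => Real.sqrt snr * X ω i + N ω i


def ee {n : ℕ} (t : ℝ) (x y : Fin n → ℝ) : ℝ :=
  Real.exp (∑ i, (t * x i * y i - (t * x i) ^ 2 / 2))

lemma gauss_shift1 (c : ℝ) : (gaussianReal 0 1).map (fun z => c + z) =
    (gaussianReal 0 1).withDensity (fun y => ENNReal.ofReal (Real.exp (c * y - c ^ 2 / 2))) := by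
  rw [gaussianReal_map_const_add, gaussianReal_of_var_ne_zero _ one_ne_zero,
    gaussianReal_of_var_ne_zero _ one_ne_zero, ← withDensity_mul _ (by fun_prop) (by fun_prop)]
  congr 1
  ext y
  simp only [Pi.mul_apply, gaussianPDF]
  rw [← ENNReal.ofReal_mul (gaussianPDFReal_nonneg _ _ _)]
  congr 1
  simp only [gaussianPDFReal]
  rw [mul_assoc (√_)⁻¹, ← Real.exp_add]
  congr 2
  simp
  ring

lemma gauss_shift {n : ℕ} (c : Fin n → ℝ) :
    (Measure.pi fun _ : Fin n => gaussianReal 0 1).map (fun z i => c i + z i) =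
    (Measure.pi fun _ : Fin n => gaussianReal 0 1).withDensity
      (fun y => ENNReal.ofReal (Real.exp (∑ i, (c i * y i - c i ^ 2 / 2)))) := by
  rw [Measure.pi_map_pi (f := fun i z => c i + z) (fun i => by fun_prop)]
  simp_rw [gauss_shift1]
  have : ∀ i, IsProbabilityMeasure ((gaussianReal 0 1).withDensity
      (fun y => ENNReal.ofReal (Real.exp (c i * y - c i ^ 2 / 2)))) := by
    intro i
    rw [← gauss_shift1, gaussianReal_map_const_add]
    infer_instance
  refine Measure.pi_eq ?_ |>.symm.symm
  intro s hs
  have hpi : MeasurableSet (Set.univ.pi s) := MeasurableSet.univ_pi hs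
  rw [withDensity_apply _ hpi, ← lintegral_indicator hpi]
  have h1 : ∀ y : Fin n → ℝ, (Set.univ.pi s).indicator (fun y => ENNReal.ofReal (Real.exp (∑ i, (c i * y i - c i ^ 2 / 2)))) y
      = ∏ i, (s i).indicator (fun y => ENNReal.ofReal (Real.exp (c i * y - c i ^ 2 / 2))) (y i) := by
    intro y
    by_cases hy : y ∈ Set.univ.pi s
    · rw [Set.indicator_of_mem hy, Real.exp_sum, ENNReal.ofReal_prod_of_nonneg (fun i _ => (Real.exp_pos _).le)]
      refine Finset.prod_congr rfl fun i _ => ?_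
      rw [Set.indicator_of_mem (hy i trivial)]
    · rw [Set.indicator_of_notMem hy]
      simp only [Set.mem_pi, not_forall] at hy
      obtain ⟨i, _, hi⟩ := hy
      rw [Finset.prod_eq_zero (Finset.mem_univ i)]
      rw [Set.indicator_of_notMem hi]
  simp_rw [h1]
  have hm : ∀ i, Measurable ((s i).indicator (fun y => ENNReal.ofReal (Real.exp (c i * y - c i ^ 2 / 2)))) :=
    fun i => Measurable.indicator (by fun_prop) (hs i)
  rw [lintegral_prod_eq_prod_lintegral_of_indepFun Finset.univ
    (fun i (y : Fin n → ℝ) => (s i).indicator (fun y => ENNReal.ofReal (Real.exp (c i * y - c i ^ 2 / 2))) (y i))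
    (iIndepFun_pi (fun i => (hm i).aemeasurable)) (fun i => (hm i).comp (measurable_pi_apply i))]
  refine Finset.prod_congr rfl fun i _ => ?_
  rw [withDensity_apply _ (hs i), ← lintegral_indicator (hs i)]
  exact (measurePreserving_eval (fun _ : Fin n => gaussianReal 0 1) i).lintegral_comp (hm i)

lemma ee_pos {n : ℕ} (t : ℝ) (x y : Fin n → ℝ) : 0 < ee t x y := Real.exp_pos _

@[fun_prop]
lemma ee_measurable {n : ℕ} : Measurable (fun p : ℝ × (Fin n → ℝ) × (Fin n → ℝ) => ee p.1 p.2.1 p.2.2) := by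
  unfold ee; fun_prop

lemma ee_le {n : ℕ} (t : ℝ) (x y : Fin n → ℝ) : ee t x y ≤ Real.exp (∑ i, y i ^ 2 / 2) := by
  unfold ee
  refine Real.exp_le_exp.2 (Finset.sum_le_sum fun i _ => ?_)
  nlinarith [sq_nonneg (t * x i - y i)]

/-- The joint law. -/
lemma joint_law {Ω : Type*} [MeasurableSpace Ω] (μ : Measure Ω) [IsProbabilityMeasure μ]
    {n : ℕ} (X N : Ω → Fin n → ℝ)
    (hX : Measurable X) (hN : Measurable N)
    (hXN : IndepFun X N μ)
    (hN_law : μ.map N = Measure.pi fun _ : Fin n => gaussianReal 0 1) (t : ℝ) :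
    μ.map (fun ω => (X ω, fun i => t * X ω i + N ω i)) =
      ((μ.map X).prod (Measure.pi fun _ : Fin n => gaussianReal 0 1)).withDensity
        (fun p => ENNReal.ofReal (ee t p.1 p.2)) := by
  have h1 := (indepFun_iff_map_prod_eq_prod_map_map hX.aemeasurable hN.aemeasurable).1 hXN
  rw [hN_law] at h1
  have : IsProbabilityMeasure (μ.map X) := Measure.isProbabilityMeasure_map hX.aemeasurable
  have hφ : Measurable (fun p : (Fin n → ℝ) × (Fin n → ℝ) => (p.1, fun i => t * p.1 i + p.2 i)) := by
    fun_prop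
  have h2 : μ.map (fun ω => (X ω, fun i => t * X ω i + N ω i)) =
      (μ.map (fun ω => (X ω, N ω))).map (fun p => (p.1, fun i => t * p.1 i + p.2 i)) := by
    rw [Measure.map_map hφ (by fun_prop)]
    rfl
  rw [h2, h1]
  refine Measure.ext_of_lintegral _ fun f hf => ?_
  have he : Measurable (fun p : (Fin n → ℝ) × (Fin n → ℝ) => ENNReal.ofReal (ee t p.1 p.2)) := by
    unfold ee; fun_prop
  rw [lintegral_map hf hφ,
    lintegral_prod (fun p : (Fin n → ℝ) × (Fin n → ℝ) => f (p.1, fun i => t * p.1 i + p.2 i)) (hf.comp hφ).aemeasurable,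
    lintegral_withDensity_eq_lintegral_mul _ he hf, lintegral_prod _ (he.mul hf).aemeasurable]
  refine lintegral_congr fun x => ?_
  have h3 := gauss_shift (fun i => t * x i)
  have hfx : Measurable (fun y => f (x, y)) := hf.comp (by fun_prop)
  have h4 : ∫⁻ y, f (x, y) ∂((Measure.pi fun _ : Fin n => gaussianReal 0 1).map (fun z i => t * x i + z i)) = _ :=
    congrArg (fun m => ∫⁻ y, f (x, y) ∂m) h3
  rw [lintegral_map hfx (by fun_prop), lintegral_withDensity_eq_lintegral_mul _ (by fun_prop) hfx] at h4
  rw [h4]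
  rfl

def MM {n : ℕ} (P : Measure (Fin n → ℝ)) (g : (Fin n → ℝ) → ℝ) (t : ℝ) (y : Fin n → ℝ) : ℝ :=
  ∫ x, g x * ee t x y ∂P

def KK {n : ℕ} (P : Measure (Fin n → ℝ)) (g : (Fin n → ℝ) → ℝ) (t : ℝ) (y : Fin n → ℝ) : ℝ :=
  MM P g t y / MM P (fun _ => 1) t y

section analysis
set_option linter.unusedSectionVars false
variable {n : ℕ} (P : Measure (Fin n → ℝ)) [IsProbabilityMeasure P]

lemma ee_measurable' (t : ℝ) (y : Fin n → ℝ) : Measurable (fun x => ee t x y) := by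
  unfold ee; fun_prop

lemma integrable_ge {g : (Fin n → ℝ) → ℝ} (hg : Integrable g P) (t : ℝ) (y : Fin n → ℝ) :
    Integrable (fun x => g x * ee t x y) P :=
  hg.mul_bdd (c := Real.exp (∑ i, y i ^ 2 / 2)) (ee_measurable' t y).aestronglyMeasurable
    (ae_of_all _ fun x => by rw [Real.norm_of_nonneg (ee_pos t x y).le]; exact ee_le t x y)

lemma LL_pos (t : ℝ) (y : Fin n → ℝ) : 0 < MM P (fun _ => 1) t y := by
  have hi := integrable_ge P (integrable_const (1 : ℝ)) t y
  unfold MM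
  rw [integral_pos_iff_support_of_nonneg (fun x => by simpa using (ee_pos t x y).le) hi]
  have : Function.support (fun x => 1 * ee t x y) = Set.univ := by
    ext x; simp [(ee_pos t x y).ne']
  rw [this]; simp

lemma MM_measurable {g : (Fin n → ℝ) → ℝ} (hg : Measurable g) :
    Measurable (fun p : ℝ × (Fin n → ℝ) => MM P g p.1 p.2) := by
  have h : StronglyMeasurable (fun q : (ℝ × (Fin n → ℝ)) × (Fin n → ℝ) => g q.2 * ee q.1.1 q.2 q.1.2) := by
    refine Measurable.stronglyMeasurable ((hg.comp measurable_snd).mul ?_)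
    unfold ee; fun_prop
  exact h.integral_prod_right.measurable

lemma KK_measurable {g : (Fin n → ℝ) → ℝ} (hg : Measurable g) :
    Measurable (fun p : ℝ × (Fin n → ℝ) => KK P g p.1 p.2) :=
  (MM_measurable P hg).div (MM_measurable P measurable_const)

lemma KK_measurable' {g : (Fin n → ℝ) → ℝ} (hg : Measurable g) (t : ℝ) :
    Measurable (fun y => KK P g t y) := by
  have h : Measurable (fun y : Fin n → ℝ => ((t, y) : ℝ × (Fin n → ℝ))) := by fun_prop
  have h2 := Measurable.comp (KK_measurable P hg) h
  simp only [Function.comp_def] at h2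
  exact h2

/-- local bound for the kernel along the path -/
lemma ee_path_le (a b : Fin n → ℝ) {t R : ℝ} (ht : |t| ≤ R) (x : Fin n → ℝ) :
    ee t x (fun i => t * a i + b i) ≤ Real.exp (∑ i, (R ^ 2 * a i ^ 2 + b i ^ 2)) := by
  refine (ee_le _ _ _).trans (Real.exp_le_exp.2 (Finset.sum_le_sum fun i _ => ?_))
  have h : t ^ 2 ≤ R ^ 2 := sq_le_sq' (by linarith [neg_abs_le t]) (by linarith [le_abs_self t])
  have h2 : t ^ 2 * a i ^ 2 ≤ R ^ 2 * a i ^ 2 := mul_le_mul_of_nonneg_right h (sq_nonneg _)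
  nlinarith [sq_nonneg (t * a i - b i)]

lemma eventually_abs_le (t : ℝ) : ∀ᶠ s in 𝓝 t, |s| ≤ |t| + 1 := by
  have : ∀ᶠ s in 𝓝 t, |s| < |t| + 1 := continuous_abs.continuousAt.eventually_lt
    continuousAt_const (by linarith)
  exact this.mono fun s hs => hs.le

lemma ee_path_hasDerivAt (a b x : Fin n → ℝ) (t : ℝ) :
    HasDerivAt (fun t => ee t x (fun i => t * a i + b i))
      ((∑ i, ((2 * t * a i + b i) * x i - t * x i ^ 2)) * ee t x (fun i => t * a i + b i)) t := by
  unfold ee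
  have h : HasDerivAt (fun t : ℝ => ∑ i, (t * x i * (t * a i + b i) - (t * x i) ^ 2 / 2))
      (∑ i, ((2 * t * a i + b i) * x i - t * x i ^ 2)) t := by
    refine HasDerivAt.fun_sum fun i _ => ?_
    have h1 : HasDerivAt (fun t : ℝ => t * x i) (1 * x i) t := (hasDerivAt_id t).mul_const _
    have h2 : HasDerivAt (fun t : ℝ => t * a i + b i) (1 * a i) t :=
      ((hasDerivAt_id t).mul_const _).add_const _
    refine (((h1.mul h2).sub ((h1.pow 2).div_const 2)).congr_deriv ?_)
    simp; ring
  rw [mul_comm]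
  exact h.exp

lemma MM_path_continuous {g : (Fin n → ℝ) → ℝ} (hg : Integrable g P) (a b : Fin n → ℝ) :
    Continuous (fun t => MM P g t (fun i => t * a i + b i)) := by
  rw [continuous_iff_continuousAt]
  intro t
  refine continuousAt_of_dominated
    (bound := fun x => ‖g x‖ * Real.exp (∑ i, ((|t| + 1) ^ 2 * a i ^ 2 + b i ^ 2))) ?_ ?_ ?_ ?_
  · exact Eventually.of_forall fun s => (integrable_ge P hg s _).aestronglyMeasurable
  · filter_upwards [eventually_abs_le t] with s hs
    refine ae_of_all _ fun x => ?_
    rw [norm_mul, Real.norm_of_nonneg (ee_pos s x _).le]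
    exact mul_le_mul_of_nonneg_left (ee_path_le a b hs x) (norm_nonneg _)
  · exact hg.norm.mul_const _
  · refine ae_of_all _ fun x => ?_
    exact continuousAt_const.mul (ee_path_hasDerivAt a b x t).continuousAt

lemma KK_path_continuous {g : (Fin n → ℝ) → ℝ} (hg : Integrable g P) (a b : Fin n → ℝ) :
    Continuous (fun t => KK P g t (fun i => t * a i + b i)) :=
  (MM_path_continuous P hg a b).div (MM_path_continuous P (integrable_const 1) a b)
    fun t => (LL_pos P t _).ne'

variable (hP : ∀ i, Integrable (fun x : Fin n → ℝ => x i ^ 2) P)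

lemma integrable_coord {hP : ∀ i, Integrable (fun x : Fin n → ℝ => x i ^ 2) P} (i : Fin n) :
    Integrable (fun x : Fin n → ℝ => x i) P := by
  refine Integrable.mono' ((integrable_const (1 : ℝ)).add (hP i))
    (measurable_pi_apply i).aestronglyMeasurable (ae_of_all _ fun x => ?_)
  simp only [Pi.add_apply, Real.norm_eq_abs]
  rcases abs_cases (x i) with h | h <;> nlinarith [sq_nonneg (x i - 1), sq_nonneg (x i + 1)]

def DD (P : Measure (Fin n → ℝ)) (a b : Fin n → ℝ) (t : ℝ) : ℝ :=
  ∑ i, ((2 * t * a i + b i) * KK P (fun x => x i) t (fun i => t * a i + b i)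
    - t * KK P (fun x => x i ^ 2) t (fun i => t * a i + b i))

lemma LL_path_hasDerivAt {hP : ∀ i, Integrable (fun x : Fin n → ℝ => x i ^ 2) P}
    (a b : Fin n → ℝ) (t : ℝ) :
    HasDerivAt (fun t => MM P (fun _ => 1) t (fun i => t * a i + b i))
      (∑ i, ((2 * t * a i + b i) * MM P (fun x => x i) t (fun i => t * a i + b i)
        - t * MM P (fun x => x i ^ 2) t (fun i => t * a i + b i))) t := by
  have h1 := fun i => integrable_coord P (hP := hP) i
  have key := hasDerivAt_integral_of_dominated_loc_of_deriv_le (μ := P) (x₀ := t)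
    (F := fun t x => 1 * ee t x (fun i => t * a i + b i))
    (F' := fun t x => (∑ i, ((2 * t * a i + b i) * x i - t * x i ^ 2)) * ee t x (fun i => t * a i + b i))
    (s := {s | |s| ≤ |t| + 1})
    (bound := fun x => (∑ i, ((2 * (|t| + 1) * |a i| + |b i|) * |x i| + (|t| + 1) * x i ^ 2)) *
      Real.exp (∑ i, ((|t| + 1) ^ 2 * a i ^ 2 + b i ^ 2)))
    (eventually_abs_le t)
    (Eventually.of_forall fun s => (integrable_ge P (integrable_const 1) s _).aestronglyMeasurable)
    (integrable_ge P (integrable_const 1) t _)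
    (by
      refine Measurable.aestronglyMeasurable (Measurable.mul (by fun_prop) (ee_measurable' _ _)))
    (by
      refine ae_of_all _ fun x s hs => ?_
      rw [norm_mul, Real.norm_of_nonneg (ee_pos s x _).le]
      refine mul_le_mul ?_ (ee_path_le a b hs x) (ee_pos s x _).le ?_
      · refine (norm_sum_le _ _).trans (Finset.sum_le_sum fun i _ => ?_)
        refine (norm_sub_le _ _).trans (add_le_add ?_ ?_)
        · rw [norm_mul]
          refine mul_le_mul_of_nonneg_right ?_ (norm_nonneg _)
          refine (norm_add_le _ _).trans (add_le_add ?_ le_rfl)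
          rw [norm_mul, norm_mul, Real.norm_eq_abs, Real.norm_eq_abs, Real.norm_eq_abs, abs_two]
          have : |s| ≤ |t| + 1 := hs
          gcongr
        · rw [norm_mul, Real.norm_of_nonneg (sq_nonneg (x i))]
          exact mul_le_mul_of_nonneg_right hs (sq_nonneg _)
      · positivity)
    (by
      refine Integrable.mul_const (integrable_finsetSum _ fun i _ => ?_) _
      exact ((h1 i).abs.const_mul _).add ((hP i).const_mul _))
    (by
      refine ae_of_all _ fun x s hs => ?_
      simpa only [one_mul] using ee_path_hasDerivAt a b x s)
  refine key.2.congr_deriv ?_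
  symm
  unfold MM
  simp_rw [Finset.sum_mul, sub_mul, mul_assoc]
  rw [integral_finsetSum]
  · refine Finset.sum_congr rfl fun i _ => ?_
    rw [integral_sub, integral_const_mul, integral_const_mul]
    · exact (integrable_ge P (h1 i) t _).const_mul _
    · exact (integrable_ge P (hP i) t _).const_mul _
  · intro i _
    exact ((integrable_ge P (h1 i) t _).const_mul _).sub ((integrable_ge P (hP i) t _).const_mul _)

lemma logLL_path_hasDerivAt {hP : ∀ i, Integrable (fun x : Fin n → ℝ => x i ^ 2) P}
    (a b : Fin n → ℝ) (t : ℝ) :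
    HasDerivAt (fun t => Real.log (MM P (fun _ => 1) t (fun i => t * a i + b i))) (DD P a b t) t := by
  convert (LL_path_hasDerivAt P (hP := hP) a b t).log (LL_pos P t _).ne' using 1
  unfold DD KK
  rw [Finset.sum_div]
  refine Finset.sum_congr rfl fun i _ => ?_
  ring

lemma DD_continuous {hP : ∀ i, Integrable (fun x : Fin n → ℝ => x i ^ 2) P} (a b : Fin n → ℝ) :
    Continuous (DD P a b) := by
  unfold DD
  refine continuous_finsetSum _ fun i _ => ?_
  have h1 := KK_path_continuous P (integrable_coord P (hP := hP) i) a b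
  have h2 := KK_path_continuous P (hP i) a b
  fun_prop

lemma logLL_eq {hP : ∀ i, Integrable (fun x : Fin n → ℝ => x i ^ 2) P} (a b : Fin n → ℝ) (T : ℝ) :
    Real.log (MM P (fun _ => 1) T (fun i => T * a i + b i)) = ∫ t in 0..T, DD P a b t := by
  rw [intervalIntegral.integral_eq_sub_of_hasDerivAt
    (fun t _ => logLL_path_hasDerivAt P (hP := hP) a b t)
    ((DD_continuous P (hP := hP) a b).intervalIntegrable _ _)]
  simp [MM, ee]

lemma KK_sq_le {hP : ∀ i, Integrable (fun x : Fin n → ℝ => x i ^ 2) P} (i : Fin n) (t : ℝ) (y : Fin n → ℝ) :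
    KK P (fun x => x i) t y ^ 2 ≤ KK P (fun x => x i ^ 2) t y := by
  have hL := LL_pos P t y
  set m := KK P (fun x => x i) t y with hm
  have h1 := integrable_ge P (integrable_coord P (hP := hP) i) t y
  have h2 := integrable_ge P (hP i) t y
  have h0 := integrable_ge P (integrable_const (1 : ℝ)) t y
  have h : 0 ≤ ∫ x, (x i - m) ^ 2 * ee t x y ∂P :=
    integral_nonneg fun x => mul_nonneg (sq_nonneg _) (ee_pos t x y).le
  have h' : ∫ x, (x i - m) ^ 2 * ee t x y ∂P =
      MM P (fun x => x i ^ 2) t y - 2 * m * MM P (fun x => x i) t y + m ^ 2 * MM P (fun _ => 1) t y := by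
    unfold MM
    have e1 : Integrable (fun x => x i ^ 2 * ee t x y - 2 * m * (x i * ee t x y)) P :=
      h2.sub (h1.const_mul _)
    rw [← integral_const_mul, ← integral_const_mul, ← integral_sub h2 (h1.const_mul _),
      ← integral_add e1 (h0.const_mul _)]
    refine integral_congr_ae (ae_of_all _ fun x => ?_)
    ring
  have h3 : MM P (fun x => x i) t y = m * MM P (fun _ => 1) t y := by
    rw [hm, KK, div_mul_cancel₀ _ hL.ne']
  rw [h', h3] at h
  rw [KK, le_div_iff₀ hL]
  nlinarith

lemma KK_sq_nonneg (i : Fin n) (t : ℝ) (y : Fin n → ℝ) : 0 ≤ KK P (fun x => x i ^ 2) t y :=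
  div_nonneg (integral_nonneg fun x => mul_nonneg (sq_nonneg _) (ee_pos t x y).le) (LL_pos P t y).le

end analysis

section prob
set_option linter.unusedSectionVars false
variable {Ω : Type*} [MeasurableSpace Ω] {μ : Measure Ω} [IsProbabilityMeasure μ]
    {n : ℕ} {X N : Ω → Fin n → ℝ}

def YY (X N : Ω → Fin n → ℝ) (t : ℝ) (ω : Ω) : Fin n → ℝ := fun i => t * X ω i + N ω i

lemma YY_measurable (hX : Measurable X) (hN : Measurable N) (t : ℝ) : Measurable (YY X N t) := by
  unfold YY; fun_prop

lemma YY_measurable2 (hX : Measurable X) (hN : Measurable N) :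
    Measurable (fun p : ℝ × Ω => YY X N p.1 p.2) := by
  unfold YY; fun_prop

lemma ofReal_ee_measurable (t : ℝ) :
    Measurable (fun p : (Fin n → ℝ) × (Fin n → ℝ) => ENNReal.ofReal (ee t p.1 p.2)) := by
  unfold ee; fun_prop

lemma LL_measurable (P : Measure (Fin n → ℝ)) [IsProbabilityMeasure P] (t : ℝ) :
    Measurable (fun y => MM P (fun _ => 1) t y) := by
  have h : Measurable (fun y : Fin n → ℝ => ((t, y) : ℝ × (Fin n → ℝ))) := by fun_prop
  have h2 := Measurable.comp (MM_measurable P (g := fun _ => 1) measurable_const) h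
  simp only [Function.comp_def] at h2
  exact h2

lemma law_Y (hX : Measurable X) (hN : Measurable N) (hXN : IndepFun X N μ)
    (hN_law : μ.map N = Measure.pi fun _ : Fin n => gaussianReal 0 1) (t : ℝ) :
    μ.map (YY X N t) = (Measure.pi fun _ : Fin n => gaussianReal 0 1).withDensity
      (fun y => ENNReal.ofReal (MM (μ.map X) (fun _ => 1) t y)) := by
  have : IsProbabilityMeasure (μ.map X) := Measure.isProbabilityMeasure_map hX.aemeasurable
  have hJ := joint_law μ X N hX hN hXN hN_law t
  have h1 : μ.map (YY X N t) = (μ.map (fun ω => (X ω, YY X N t ω))).map Prod.snd := by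
    rw [Measure.map_map measurable_snd (hX.prodMk (YY_measurable hX hN t))]; rfl
  rw [h1]
  unfold YY
  rw [hJ]
  refine Measure.ext_of_lintegral _ fun f hf => ?_
  have he := ofReal_ee_measurable (n := n) t
  have hf2 : Measurable (fun p : (Fin n → ℝ) × (Fin n → ℝ) => f p.2) := hf.comp measurable_snd
  rw [lintegral_map hf measurable_snd, lintegral_withDensity_eq_lintegral_mul _ he hf2,
    lintegral_prod_symm _ (he.mul hf2).aemeasurable,
    lintegral_withDensity_eq_lintegral_mul _ (LL_measurable _ t).ennreal_ofReal hf]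
  refine lintegral_congr fun y => ?_
  simp only [Pi.mul_apply]
  rw [lintegral_mul_const _ (ee_measurable' t y).ennreal_ofReal]
  congr 1
  unfold MM
  rw [ofReal_integral_eq_lintegral_ofReal (integrable_ge _ (integrable_const 1) t y)
    (ae_of_all _ fun x => by simpa using (ee_pos t x y).le)]
  simp

lemma tower (hX : Measurable X) (hN : Measurable N) (hXN : IndepFun X N μ)
    (hN_law : μ.map N = Measure.pi fun _ : Fin n => gaussianReal 0 1) (t : ℝ)
    {φ g : (Fin n → ℝ) → ℝ} (hφ : Measurable φ) (hg : Measurable g)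
    (hi : Integrable (fun ω => φ (YY X N t ω) * g (X ω)) μ) :
    Integrable (fun ω => φ (YY X N t ω) * KK (μ.map X) g t (YY X N t ω)) μ ∧
    ∫ ω, φ (YY X N t ω) * KK (μ.map X) g t (YY X N t ω) ∂μ = ∫ ω, φ (YY X N t ω) * g (X ω) ∂μ := by
  have : IsProbabilityMeasure (μ.map X) := Measure.isProbabilityMeasure_map hX.aemeasurable
  have hJ : μ.map (fun ω => (X ω, YY X N t ω)) = _ := joint_law μ X N hX hN hXN hN_law t
  have hY := law_Y hX hN hXN hN_law t
  have hYm := YY_measurable hX hN t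
  have hXY : Measurable (fun ω => (X ω, YY X N t ω)) := hX.prodMk hYm
  have he := ofReal_ee_measurable (n := n) t
  set γ : Measure (Fin n → ℝ) := Measure.pi fun _ : Fin n => gaussianReal 0 1 with hγ
  have hf : Measurable (fun p : (Fin n → ℝ) × (Fin n → ℝ) => φ p.2 * g p.1) := by fun_prop
  have hk : Measurable (fun y => φ y * KK (μ.map X) g t y) := hφ.mul (KK_measurable' _ hg t)
  have e1 : ∫ ω, φ (YY X N t ω) * g (X ω) ∂μ
      = ∫ p, φ p.2 * g p.1 ∂(μ.map (fun ω => (X ω, YY X N t ω))) := by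
    rw [integral_map hXY.aemeasurable hf.aestronglyMeasurable]
  have i1 : Integrable (fun p : (Fin n → ℝ) × (Fin n → ℝ) => φ p.2 * g p.1)
      (μ.map (fun ω => (X ω, YY X N t ω))) := by
    rw [integrable_map_measure hf.aestronglyMeasurable hXY.aemeasurable]; exact hi
  have e2 : ∫ ω, φ (YY X N t ω) * KK (μ.map X) g t (YY X N t ω) ∂μ
      = ∫ y, φ y * KK (μ.map X) g t y ∂(μ.map (YY X N t)) := by
    rw [integral_map hYm.aemeasurable hk.aestronglyMeasurable]
  have i2 : Integrable (fun y => φ y * KK (μ.map X) g t y) (μ.map (YY X N t)) ↔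
      Integrable (fun ω => φ (YY X N t ω) * KK (μ.map X) g t (YY X N t ω)) μ := by
    rw [integrable_map_measure hk.aestronglyMeasurable hYm.aemeasurable]; rfl
  rw [hJ, integrable_withDensity_iff_integrable_smul' he (ae_of_all _ fun _ => ENNReal.ofReal_lt_top)] at i1
  rw [hJ, integral_withDensity_eq_integral_toReal_smul he (ae_of_all _ fun _ => ENNReal.ofReal_lt_top),
    integral_prod_symm _ i1] at e1
  have hL := (LL_measurable (μ.map X) t).ennreal_ofReal
  rw [hY, integral_withDensity_eq_integral_toReal_smul hL (ae_of_all _ fun _ => ENNReal.ofReal_lt_top)] at e2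
  rw [hY, integrable_withDensity_iff_integrable_smul' hL (ae_of_all _ fun _ => ENNReal.ofReal_lt_top)] at i2
  have key : ∀ y, ∫ x, (ENNReal.ofReal (ee t x y)).toReal • (φ y * g x) ∂(μ.map X) =
      (ENNReal.ofReal (MM (μ.map X) (fun _ => 1) t y)).toReal • (φ y * KK (μ.map X) g t y) := by
    intro y
    have hLp := LL_pos (μ.map X) t y
    rw [ENNReal.toReal_ofReal hLp.le, KK, smul_eq_mul]
    field_simp
    unfold MM
    rw [← integral_const_mul]
    refine integral_congr_ae (ae_of_all _ fun x => ?_)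
    simp only [smul_eq_mul]
    rw [ENNReal.toReal_ofReal (ee_pos t x y).le]
    ring
  have i3 := i1.integral_prod_right
  simp only [key] at i3 e1
  exact ⟨i2.1 i3, e2.trans e1.symm⟩

lemma N_coord_law (hN : Measurable N)
    (hN_law : μ.map N = Measure.pi fun _ : Fin n => gaussianReal 0 1) (i : Fin n) :
    μ.map (fun ω => N ω i) = gaussianReal 0 1 := by
  have h := (measurePreserving_eval (fun _ : Fin n => gaussianReal 0 1) i).map_eq
  rw [← hN_law, Measure.map_map (measurable_pi_apply i) hN] at h
  exact h

lemma N_sq_integrable (hN : Measurable N)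
    (hN_law : μ.map N = Measure.pi fun _ : Fin n => gaussianReal 0 1) (i : Fin n) :
    MemLp (fun ω => N ω i) 2 μ := by
  have h := memLp_id_gaussianReal (μ := 0) (v := 1) 2
  rw [← N_coord_law hN hN_law i] at h
  exact (memLp_map_measure_iff (by fun_prop) (by fun_prop)).1 h

lemma N_mean (hN : Measurable N)
    (hN_law : μ.map N = Measure.pi fun _ : Fin n => gaussianReal 0 1) (i : Fin n) :
    ∫ ω, N ω i ∂μ = 0 := by
  have h := integral_id_gaussianReal (μ := 0) (v := 1)
  rw [← N_coord_law hN hN_law i, integral_map (by fun_prop) (by fun_prop)] at h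
  exact h

lemma XN_mean (hX : Measurable X) (hN : Measurable N) (hXN : IndepFun X N μ)
    (hN_law : μ.map N = Measure.pi fun _ : Fin n => gaussianReal 0 1) (i : Fin n) :
    ∫ ω, X ω i * N ω i ∂μ = 0 := by
  have h : IndepFun (fun ω => X ω i) (fun ω => N ω i) μ :=
    hXN.comp (measurable_pi_apply i) (measurable_pi_apply i)
  have := h.integral_mul_eq_mul_integral (by fun_prop) (by fun_prop)
  rw [N_mean hN hN_law i, mul_zero] at this
  exact this

lemma memLp_X (hX : Measurable X) (hX2 : Integrable (fun ω => ∑ i, X ω i ^ 2) μ) (i : Fin n) :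
    MemLp (fun ω => X ω i) 2 μ := by
  rw [memLp_two_iff_integrable_sq (by fun_prop)]
  refine hX2.mono' (by fun_prop) (ae_of_all _ fun ω => ?_)
  rw [Real.norm_of_nonneg (sq_nonneg _)]
  exact Finset.single_le_sum (f := fun i => X ω i ^ 2) (fun i _ => sq_nonneg _) (Finset.mem_univ i)

lemma hP_of (hX : Measurable X) (hX2 : Integrable (fun ω => ∑ i, X ω i ^ 2) μ) (i : Fin n) :
    Integrable (fun x : Fin n → ℝ => x i ^ 2) (μ.map X) := by
  rw [integrable_map_measure ((measurable_pi_apply i).pow_const 2).aestronglyMeasurable hX.aemeasurable]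
  exact (memLp_X hX hX2 i).integrable_sq

lemma memLp_Y (hX : Measurable X) (hN : Measurable N)
    (hN_law : μ.map N = Measure.pi fun _ : Fin n => gaussianReal 0 1)
    (hX2 : Integrable (fun ω => ∑ i, X ω i ^ 2) μ) (t : ℝ) (i : Fin n) :
    MemLp (fun ω => YY X N t ω i) 2 μ :=
  ((memLp_X hX hX2 i).const_mul t).add (N_sq_integrable hN hN_law i)

/-- conditional second moment -/
lemma q_facts (hX : Measurable X) (hN : Measurable N) (hXN : IndepFun X N μ)
    (hN_law : μ.map N = Measure.pi fun _ : Fin n => gaussianReal 0 1)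
    (hX2 : Integrable (fun ω => ∑ i, X ω i ^ 2) μ) (t : ℝ) (i : Fin n) :
    Integrable (fun ω => KK (μ.map X) (fun x => x i ^ 2) t (YY X N t ω)) μ ∧
    ∫ ω, KK (μ.map X) (fun x => x i ^ 2) t (YY X N t ω) ∂μ = ∫ ω, X ω i ^ 2 ∂μ := by
  have := tower hX hN hXN hN_law t (φ := fun _ => 1) (g := fun x => x i ^ 2) (by fun_prop) (by fun_prop)
    (by simpa using (memLp_X hX hX2 i).integrable_sq)
  simpa using this

lemma memLp_m (hX : Measurable X) (hN : Measurable N) (hXN : IndepFun X N μ)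
    (hN_law : μ.map N = Measure.pi fun _ : Fin n => gaussianReal 0 1)
    (hX2 : Integrable (fun ω => ∑ i, X ω i ^ 2) μ) (t : ℝ) (i : Fin n) :
    MemLp (fun ω => KK (μ.map X) (fun x => x i) t (YY X N t ω)) 2 μ := by
  have : IsProbabilityMeasure (μ.map X) := Measure.isProbabilityMeasure_map hX.aemeasurable
  have hm : Measurable (fun ω => KK (μ.map X) (fun x => x i) t (YY X N t ω)) :=
    (KK_measurable' _ (measurable_pi_apply i) t).comp (YY_measurable hX hN t)
  rw [memLp_two_iff_integrable_sq hm.aestronglyMeasurable]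
  refine (q_facts hX hN hXN hN_law hX2 t i).1.mono' (hm.pow_const 2).aestronglyMeasurable
    (ae_of_all _ fun ω => ?_)
  rw [Real.norm_of_nonneg (sq_nonneg _)]
  exact KK_sq_le _ (hP := hP_of hX hX2) i t _

lemma Xm (hX : Measurable X) (hN : Measurable N) (hXN : IndepFun X N μ)
    (hN_law : μ.map N = Measure.pi fun _ : Fin n => gaussianReal 0 1)
    (hX2 : Integrable (fun ω => ∑ i, X ω i ^ 2) μ) (t : ℝ) (i : Fin n) :
    ∫ ω, X ω i * KK (μ.map X) (fun x => x i) t (YY X N t ω) ∂μ =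
      ∫ ω, KK (μ.map X) (fun x => x i) t (YY X N t ω) ^ 2 ∂μ := by
  have : IsProbabilityMeasure (μ.map X) := Measure.isProbabilityMeasure_map hX.aemeasurable
  have := tower hX hN hXN hN_law t (φ := fun y => KK (μ.map X) (fun x => x i) t y)
    (g := fun x => x i) (KK_measurable' _ (measurable_pi_apply i) t) (by fun_prop)
    ((memLp_m hX hN hXN hN_law hX2 t i).integrable_mul (memLp_X hX hX2 i))
  simp_rw [pow_two, mul_comm (X _ i)]
  exact this.2.symm

lemma Ym (hX : Measurable X) (hN : Measurable N) (hXN : IndepFun X N μ)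
    (hN_law : μ.map N = Measure.pi fun _ : Fin n => gaussianReal 0 1)
    (hX2 : Integrable (fun ω => ∑ i, X ω i ^ 2) μ) (t : ℝ) (i : Fin n) :
    ∫ ω, YY X N t ω i * KK (μ.map X) (fun x => x i) t (YY X N t ω) ∂μ =
      t * ∫ ω, X ω i ^ 2 ∂μ := by
  have h := tower hX hN hXN hN_law t (φ := fun y => y i)
    (g := fun x => x i) (measurable_pi_apply i) (by fun_prop)
    ((memLp_Y hX hN hN_law hX2 t i).integrable_mul (memLp_X hX hX2 i))
  rw [h.2]
  have : ∀ ω, YY X N t ω i * X ω i = t * X ω i ^ 2 + X ω i * N ω i := fun ω => by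
    simp only [YY]; ring
  simp_rw [this]
  have i2 : Integrable (fun ω => X ω i * N ω i) μ :=
    (memLp_X hX hX2 i).integrable_mul (N_sq_integrable hN hN_law i)
  rw [integral_add ((memLp_X hX hX2 i).integrable_sq.const_mul _) i2, XN_mean hX hN hXN hN_law i,
    integral_const_mul, add_zero]

lemma DD_integral (hX : Measurable X) (hN : Measurable N) (hXN : IndepFun X N μ)
    (hN_law : μ.map N = Measure.pi fun _ : Fin n => gaussianReal 0 1)
    (hX2 : Integrable (fun ω => ∑ i, X ω i ^ 2) μ) (t : ℝ) :
    ∫ ω, DD (μ.map X) (X ω) (N ω) t ∂μ =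
      t * ∑ i, ∫ ω, KK (μ.map X) (fun x => x i) t (YY X N t ω) ^ 2 ∂μ := by
  have e : ∀ ω, DD (μ.map X) (X ω) (N ω) t = ∑ i, (YY X N t ω i * KK (μ.map X) (fun x => x i) t (YY X N t ω)
      + t * (X ω i * KK (μ.map X) (fun x => x i) t (YY X N t ω))
      - t * KK (μ.map X) (fun x => x i ^ 2) t (YY X N t ω)) := by
    intro ω
    unfold DD
    refine Finset.sum_congr rfl fun i _ => ?_
    change (2 * t * X ω i + N ω i) * KK (μ.map X) (fun x => x i) t (YY X N t ω) -
      t * KK (μ.map X) (fun x => x i ^ 2) t (YY X N t ω) = _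
    have : YY X N t ω i = t * X ω i + N ω i := rfl
    rw [this]; ring
  simp_rw [e]
  have i1 : ∀ i, Integrable (fun ω => YY X N t ω i * KK (μ.map X) (fun x => x i) t (YY X N t ω)) μ :=
    fun i => (memLp_Y hX hN hN_law hX2 t i).integrable_mul (memLp_m hX hN hXN hN_law hX2 t i)
  have i2 : ∀ i, Integrable (fun ω => t * (X ω i * KK (μ.map X) (fun x => x i) t (YY X N t ω))) μ :=
    fun i => ((memLp_X hX hX2 i).integrable_mul (memLp_m hX hN hXN hN_law hX2 t i)).const_mul t
  have i3 : ∀ i, Integrable (fun ω => t * KK (μ.map X) (fun x => x i ^ 2) t (YY X N t ω)) μ :=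
    fun i => (q_facts hX hN hXN hN_law hX2 t i).1.const_mul t
  have i12 : ∀ i, Integrable (fun ω => YY X N t ω i * KK (μ.map X) (fun x => x i) t (YY X N t ω) +
      t * (X ω i * KK (μ.map X) (fun x => x i) t (YY X N t ω))) μ := fun i => (i1 i).add (i2 i)
  rw [integral_finsetSum, Finset.mul_sum]
  swap
  · exact fun i _ => (i12 i).sub (i3 i)
  refine Finset.sum_congr rfl fun i _ => ?_
  rw [integral_sub (i12 i) (i3 i), integral_add (i1 i) (i2 i), integral_const_mul, integral_const_mul,
    Ym hX hN hXN hN_law hX2, Xm hX hN hXN hN_law hX2, (q_facts hX hN hXN hN_law hX2 t i).2]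
  ring

end prob

section prob2
variable {Ω : Type*} [MeasurableSpace Ω] {μ : Measure Ω} [IsProbabilityMeasure μ]
    {n : ℕ} {X N : Ω → Fin n → ℝ}

lemma KKpath_measurable (hX : Measurable X) (hN : Measurable N)
    {g : (Fin n → ℝ) → ℝ} (hg : Measurable g) :
    Measurable (fun p : ℝ × Ω => KK (μ.map X) g p.1 (YY X N p.1 p.2)) := by
  have : IsProbabilityMeasure (μ.map X) := Measure.isProbabilityMeasure_map hX.aemeasurable
  have h : Measurable (fun p : ℝ × Ω => ((p.1, YY X N p.1 p.2) : ℝ × (Fin n → ℝ))) :=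
    measurable_fst.prodMk (YY_measurable2 hX hN)
  have h2 := Measurable.comp (KK_measurable (μ.map X) hg) h
  simp only [Function.comp_def] at h2
  exact h2

lemma DD_measurable (hX : Measurable X) (hN : Measurable N) :
    Measurable (fun p : ℝ × Ω => DD (μ.map X) (X p.2) (N p.2) p.1) := by
  unfold DD
  refine Finset.measurable_sum _ fun i _ => ?_
  have h1 : Measurable (fun p : ℝ × Ω => KK (μ.map X) (fun x => x i) p.1 (fun i => p.1 * X p.2 i + N p.2 i)) :=
    KKpath_measurable (μ := μ) hX hN (measurable_pi_apply i)
  have h2 : Measurable (fun p : ℝ × Ω => KK (μ.map X) (fun x => x i ^ 2) p.1 (fun i => p.1 * X p.2 i + N p.2 i)) :=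
    KKpath_measurable (μ := μ) hX hN ((measurable_pi_apply i).pow_const 2)
  have h3 : Measurable (fun p : ℝ × Ω => (2 * p.1 * X p.2 i + N p.2 i)) := by fun_prop
  exact (h3.mul h1).sub (measurable_fst.mul h2)

lemma DD_integrable_prod (hX : Measurable X) (hN : Measurable N) (hXN : IndepFun X N μ)
    (hN_law : μ.map N = Measure.pi fun _ : Fin n => gaussianReal 0 1)
    (hX2 : Integrable (fun ω => ∑ i, X ω i ^ 2) μ) (T : ℝ) :
    Integrable (fun p : ℝ × Ω => DD (μ.map X) (X p.2) (N p.2) p.1)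
      ((volume.restrict (Set.Ioc 0 T)).prod μ) := by
  have : IsProbabilityMeasure (μ.map X) := Measure.isProbabilityMeasure_map hX.aemeasurable
  have hq : ∀ i, Integrable (fun p : ℝ × Ω => KK (μ.map X) (fun x => x i ^ 2) p.1 (YY X N p.1 p.2))
      ((volume.restrict (Set.Ioc 0 T)).prod μ) := by
    intro i
    rw [integrable_prod_iff (KKpath_measurable hX hN ((measurable_pi_apply i).pow_const 2)).aestronglyMeasurable]
    refine ⟨ae_of_all _ fun t => (q_facts hX hN hXN hN_law hX2 t i).1, ?_⟩
    have : ∀ t, ∫ ω, ‖KK (μ.map X) (fun x => x i ^ 2) t (YY X N t ω)‖ ∂μ = ∫ ω, X ω i ^ 2 ∂μ := by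
      intro t
      rw [← (q_facts hX hN hXN hN_law hX2 t i).2]
      refine integral_congr_ae (ae_of_all _ fun ω => ?_)
      exact Real.norm_of_nonneg (KK_sq_nonneg _ i t _)
    simp only [this]
    exact integrable_const _
  have hXs : ∀ i, Integrable (fun p : ℝ × Ω => X p.2 i ^ 2) ((volume.restrict (Set.Ioc 0 T)).prod μ) :=
    fun i => (memLp_X hX hX2 i).integrable_sq.comp_snd _
  have hNs : ∀ i, Integrable (fun p : ℝ × Ω => N p.2 i ^ 2) ((volume.restrict (Set.Ioc 0 T)).prod μ) :=
    fun i => (N_sq_integrable hN hN_law i).integrable_sq.comp_snd _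
  have hb : Integrable (fun p : ℝ × Ω => ∑ i, (4 * T ^ 2 * X p.2 i ^ 2 + N p.2 i ^ 2 +
      (1 / 2 + T) * KK (μ.map X) (fun x => x i ^ 2) p.1 (YY X N p.1 p.2)))
      ((volume.restrict (Set.Ioc 0 T)).prod μ) :=
    integrable_finsetSum _ fun i _ => (((hXs i).const_mul _).add (hNs i)).add ((hq i).const_mul _)
  refine hb.mono' (DD_measurable hX hN).aestronglyMeasurable ?_
  have hset : ∀ᵐ p ∂((volume.restrict (Set.Ioc 0 T)).prod μ), p.1 ∈ Set.Ioc 0 T :=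
    Measure.quasiMeasurePreserving_fst.ae (ae_restrict_mem measurableSet_Ioc)
  filter_upwards [hset] with p hp
  unfold DD
  refine (norm_sum_le _ _).trans (Finset.sum_le_sum fun i _ => ?_)
  change ‖(2 * p.1 * X p.2 i + N p.2 i) * KK (μ.map X) (fun x => x i) p.1 (YY X N p.1 p.2) -
      p.1 * KK (μ.map X) (fun x => x i ^ 2) p.1 (YY X N p.1 p.2)‖ ≤ _
  have h1 := KK_sq_le (μ.map X) (hP := hP_of hX hX2) i p.1 (YY X N p.1 p.2)
  have h2 := KK_sq_nonneg (μ.map X) i p.1 (YY X N p.1 p.2)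
  generalize KK (μ.map X) (fun x => x i) p.1 (YY X N p.1 p.2) = m at *
  generalize KK (μ.map X) (fun x => x i ^ 2) p.1 (YY X N p.1 p.2) = q at *
  generalize X p.2 i = a
  generalize N p.2 i = b
  obtain ⟨hp1, hp2⟩ := hp
  generalize p.1 = t at *
  have h3 : |(2 * t * a + b) * m| ≤ (2 * t * a + b) ^ 2 / 2 + m ^ 2 / 2 := by
    rw [abs_le]
    constructor <;> nlinarith [sq_nonneg (2 * t * a + b + m), sq_nonneg (2 * t * a + b - m)]
  have h4 : |t * q| ≤ T * q := by
    rw [abs_of_nonneg (by positivity)]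
    exact mul_le_mul_of_nonneg_right hp2 h2
  have h5 : (2 * t * a + b) ^ 2 / 2 ≤ 4 * t ^ 2 * a ^ 2 + b ^ 2 := by
    nlinarith [sq_nonneg (2 * t * a - b)]
  have h6 : t ^ 2 * a ^ 2 ≤ T ^ 2 * a ^ 2 :=
    mul_le_mul_of_nonneg_right (by nlinarith) (sq_nonneg _)
  rw [Real.norm_eq_abs]
  refine (abs_sub _ _).trans ?_
  nlinarith

lemma logLL_facts (hX : Measurable X) (hN : Measurable N) (hXN : IndepFun X N μ)
    (hN_law : μ.map N = Measure.pi fun _ : Fin n => gaussianReal 0 1)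
    (hX2 : Integrable (fun ω => ∑ i, X ω i ^ 2) μ) {T : ℝ} (hT : 0 ≤ T) :
    Integrable (fun ω => Real.log (MM (μ.map X) (fun _ => 1) T (YY X N T ω))) μ ∧
    ∫ ω, Real.log (MM (μ.map X) (fun _ => 1) T (YY X N T ω)) ∂μ =
      ∫ t in 0..T, t * ∑ i, ∫ ω, KK (μ.map X) (fun x => x i) t (YY X N t ω) ^ 2 ∂μ := by
  have : IsProbabilityMeasure (μ.map X) := Measure.isProbabilityMeasure_map hX.aemeasurable
  have hD := DD_integrable_prod hX hN hXN hN_law hX2 T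
  have e : ∀ ω, Real.log (MM (μ.map X) (fun _ => 1) T (YY X N T ω)) =
      ∫ t in Set.Ioc 0 T, DD (μ.map X) (X ω) (N ω) t := by
    intro ω
    rw [← intervalIntegral.integral_of_le hT]
    exact logLL_eq (μ.map X) (hP := hP_of hX hX2) (X ω) (N ω) T
  simp_rw [e]
  refine ⟨hD.integral_prod_right, ?_⟩
  rw [intervalIntegral.integral_of_le hT]
  rw [← integral_integral_swap (f := fun t ω => DD (μ.map X) (X ω) (N ω) t) hD]
  simp_rw [DD_integral hX hN hXN hN_law hX2]

/-- Continuity of the mean-square of the conditional mean (Fatou twice). -/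
lemma H_continuous (hX : Measurable X) (hN : Measurable N) (hXN : IndepFun X N μ)
    (hN_law : μ.map N = Measure.pi fun _ : Fin n => gaussianReal 0 1)
    (hX2 : Integrable (fun ω => ∑ i, X ω i ^ 2) μ) (i : Fin n) :
    Continuous (fun t => ∫ ω, KK (μ.map X) (fun x => x i) t (YY X N t ω) ^ 2 ∂μ) := by
  have hpm : IsProbabilityMeasure (μ.map X) := Measure.isProbabilityMeasure_map hX.aemeasurable
  set m : ℝ → Ω → ℝ := fun t ω => KK (μ.map X) (fun x => x i) t (YY X N t ω) with hm
  set q : ℝ → Ω → ℝ := fun t ω => KK (μ.map X) (fun x => x i ^ 2) t (YY X N t ω) with hq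
  have hmm : ∀ t, Measurable (m t) := fun t =>
    (KK_measurable' _ (measurable_pi_apply i) t).comp (YY_measurable hX hN t)
  have hqm : ∀ t, Measurable (q t) := fun t =>
    (KK_measurable' _ ((measurable_pi_apply i).pow_const 2) t).comp (YY_measurable hX hN t)
  have hle : ∀ t ω, m t ω ^ 2 ≤ q t ω := fun t ω => KK_sq_le (μ.map X) (hP := hP_of hX hX2) i t _
  have hmc : ∀ ω, Continuous (fun t => m t ω) := fun ω =>
    KK_path_continuous (μ.map X) (integrable_coord _ (hP := hP_of hX hX2) i) (X ω) (N ω)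
  have hqc : ∀ ω, Continuous (fun t => q t ω) := fun ω =>
    KK_path_continuous (μ.map X) (hP_of hX hX2 i) (X ω) (N ω)
  have hqi : ∀ t, Integrable (q t) μ := fun t => (q_facts hX hN hXN hN_law hX2 t i).1
  have hqe : ∀ t, ∫ ω, q t ω ∂μ = ∫ ω, X ω i ^ 2 ∂μ := fun t => (q_facts hX hN hXN hN_law hX2 t i).2
  have hmi : ∀ t, Integrable (fun ω => m t ω ^ 2) μ := fun t => (memLp_m hX hN hXN hN_law hX2 t i).integrable_sq
  -- Fatou in real form
  have fatou : ∀ (f : ℝ → Ω → ℝ), (∀ t, Measurable (f t)) → (∀ t ω, 0 ≤ f t ω) →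
      (∀ t, Integrable (f t) μ) → (∀ ω, Continuous (fun t => f t ω)) →
      ∀ t₀ ε, 0 < ε → ∀ᶠ t in 𝓝 t₀, ∫ ω, f t₀ ω ∂μ - ε < ∫ ω, f t ω ∂μ := by
    intro f hf hf0 hfi hfc t₀ ε hε
    have h := lintegral_liminf_le (μ := μ) (u := 𝓝 t₀) (f := fun t ω => ENNReal.ofReal (f t ω))
      (fun t => (hf t).ennreal_ofReal)
    have h2 : ∀ ω, liminf (fun t => ENNReal.ofReal (f t ω)) (𝓝 t₀) = ENNReal.ofReal (f t₀ ω) := fun ω =>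
      ((ENNReal.continuous_ofReal.comp (hfc ω)).tendsto t₀).liminf_eq
    simp only [h2] at h
    simp_rw [← ofReal_integral_eq_lintegral_ofReal (hfi _) (ae_of_all _ (hf0 _))] at h
    by_cases hpos : ∫ ω, f t₀ ω ∂μ - ε < 0
    · exact Eventually.of_forall fun t => hpos.trans_le (integral_nonneg (hf0 t))
    have hlt : ENNReal.ofReal (∫ ω, f t₀ ω ∂μ - ε) < ENNReal.ofReal (∫ ω, f t₀ ω ∂μ) := by
      rw [ENNReal.ofReal_lt_ofReal_iff (by linarith [not_lt.1 hpos])]; linarith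
    have h3 := eventually_lt_of_lt_liminf (hlt.trans_le h)
    filter_upwards [h3] with t ht
    by_contra hcon
    exact absurd (ENNReal.ofReal_le_ofReal (not_lt.1 hcon)) (not_le.2 ht)
  rw [continuous_iff_continuousAt]
  intro t₀
  rw [ContinuousAt, Metric.tendsto_nhds]
  intro ε hε
  have f1 := fatou (fun t ω => m t ω ^ 2) (fun t => (hmm t).pow_const 2) (fun t ω => sq_nonneg _) hmi
    (fun ω => (hmc ω).pow 2) t₀ ε hε
  have f2 := fatou (fun t ω => q t ω - m t ω ^ 2) (fun t => (hqm t).sub ((hmm t).pow_const 2))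
    (fun t ω => sub_nonneg.2 (hle t ω)) (fun t => (hqi t).sub (hmi t))
    (fun ω => (hqc ω).sub ((hmc ω).pow 2)) t₀ ε hε
  filter_upwards [f1, f2] with t h1 h2
  rw [integral_sub (hqi t) (hmi t), integral_sub (hqi t₀) (hmi t₀), hqe, hqe] at h2
  rw [Real.dist_eq, abs_lt]
  constructor <;> linarith

lemma condExp_eq (hX : Measurable X) (hN : Measurable N) (hXN : IndepFun X N μ)
    (hN_law : μ.map N = Measure.pi fun _ : Fin n => gaussianReal 0 1)
    (hX2 : Integrable (fun ω => ∑ i, X ω i ^ 2) μ) (t : ℝ) (i : Fin n) :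
    (fun ω => KK (μ.map X) (fun x => x i) t (YY X N t ω)) =ᵐ[μ]
      μ[fun ω => X ω i | MeasurableSpace.comap (YY X N t) inferInstance] := by
  have hpm : IsProbabilityMeasure (μ.map X) := Measure.isProbabilityMeasure_map hX.aemeasurable
  have hYm := YY_measurable hX hN t
  have hXi : Integrable (fun ω => X ω i) μ := (memLp_X hX hX2 i).integrable (by norm_num)
  have hmi : Integrable (fun ω => KK (μ.map X) (fun x => x i) t (YY X N t ω)) μ :=
    (memLp_m hX hN hXN hN_law hX2 t i).integrable (by norm_num)
  refine ae_eq_condExp_of_forall_setIntegral_eq hYm.comap_le hXi (fun s _ _ => hmi.integrableOn) ?_ ?_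
  · rintro s ⟨B, hB, rfl⟩ _
    have ind : ∀ f : Ω → ℝ, ∀ ω, B.indicator (fun _ => (1 : ℝ)) (YY X N t ω) * f ω =
        (YY X N t ⁻¹' B).indicator f ω := by
      intro f ω
      by_cases h : YY X N t ω ∈ B
      · rw [Set.indicator_of_mem h, Set.indicator_of_mem (s := YY X N t ⁻¹' B) h, one_mul]
      · rw [Set.indicator_of_notMem h, Set.indicator_of_notMem (s := YY X N t ⁻¹' B) h, zero_mul]
    have h := tower hX hN hXN hN_law t (φ := B.indicator (fun _ => (1 : ℝ))) (g := fun x => x i)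
      (measurable_const.indicator hB) (measurable_pi_apply i)
      (by
        simp only [ind (fun ω => X ω i)]
        exact hXi.indicator (hYm hB))
    rw [← integral_indicator (hYm hB), ← integral_indicator (hYm hB)]
    have h' := h.2
    simp only [ind (fun ω => X ω i), ind (fun ω => KK (μ.map X) (fun x => x i) t (YY X N t ω))] at h'
    exact h'
  · refine Measurable.aestronglyMeasurable ?_
    exact (KK_measurable' _ (measurable_pi_apply i) t).comp (comap_measurable _)

lemma mmse_eq (hX : Measurable X) (hN : Measurable N) (hXN : IndepFun X N μ)
    (hN_law : μ.map N = Measure.pi fun _ : Fin n => gaussianReal 0 1)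
    (hX2 : Integrable (fun ω => ∑ i, X ω i ^ 2) μ) (t : ℝ) (i : Fin n) :
    ∫ ω, (X ω i - (μ[fun ω' => X ω' i | MeasurableSpace.comap (YY X N t) inferInstance]) ω) ^ 2 ∂μ =
      ∫ ω, X ω i ^ 2 ∂μ - ∫ ω, KK (μ.map X) (fun x => x i) t (YY X N t ω) ^ 2 ∂μ := by
  have h1 := condExp_eq hX hN hXN hN_law hX2 t i
  have hm := memLp_m hX hN hXN hN_law hX2 t i
  have hx := memLp_X hX hX2 i
  have i1 : Integrable (fun ω => X ω i * KK (μ.map X) (fun x => x i) t (YY X N t ω)) μ :=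
    hx.integrable_mul hm
  have i2 : Integrable (fun ω => X ω i ^ 2 - 2 * (X ω i * KK (μ.map X) (fun x => x i) t (YY X N t ω))) μ :=
    hx.integrable_sq.sub (i1.const_mul _)
  have e : ∫ ω, (X ω i - (μ[fun ω' => X ω' i | MeasurableSpace.comap (YY X N t) inferInstance]) ω) ^ 2 ∂μ =
      ∫ ω, (X ω i ^ 2 - 2 * (X ω i * KK (μ.map X) (fun x => x i) t (YY X N t ω))
        + KK (μ.map X) (fun x => x i) t (YY X N t ω) ^ 2) ∂μ := by
    refine integral_congr_ae ?_
    filter_upwards [h1] with ω hω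
    rw [← hω]; ring
  rw [e, integral_add i2 hm.integrable_sq, integral_sub hx.integrable_sq (i1.const_mul _),
    integral_const_mul, Xm hX hN hXN hN_law hX2]
  ring

end prob2

section final
variable {Ω : Type*} [MeasurableSpace Ω] {μ : Measure Ω} [IsProbabilityMeasure μ]
    {n : ℕ} {X N : Ω → Fin n → ℝ}

lemma mutualInfo_formula (hX : Measurable X) (hN : Measurable N) (hXN : IndepFun X N μ)
    (hN_law : μ.map N = Measure.pi fun _ : Fin n => gaussianReal 0 1)
    (hX2 : Integrable (fun ω => ∑ i, X ω i ^ 2) μ) {t : ℝ} (ht : 0 ≤ t) :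
    (mutualInfo μ X (YY X N t)).toReal = t ^ 2 / 2 * (∑ i, ∫ ω, X ω i ^ 2 ∂μ) -
      ∫ u in 0..t, u * ∑ i, ∫ ω, KK (μ.map X) (fun x => x i) u (YY X N u ω) ^ 2 ∂μ := by
  have hpm : IsProbabilityMeasure (μ.map X) := Measure.isProbabilityMeasure_map hX.aemeasurable
  have hYm := YY_measurable hX hN t
  have hpY : IsProbabilityMeasure (μ.map (YY X N t)) := Measure.isProbabilityMeasure_map hYm.aemeasurable
  have hXY : Measurable (fun ω => (X ω, YY X N t ω)) := hX.prodMk hYm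
  have hpJ : IsProbabilityMeasure (μ.map (fun ω => (X ω, YY X N t ω))) :=
    Measure.isProbabilityMeasure_map hXY.aemeasurable
  have hJ : μ.map (fun ω => (X ω, YY X N t ω)) = _ := joint_law μ X N hX hN hXN hN_law t
  have hY := law_Y hX hN hXN hN_law t
  have hL := LL_measurable (μ.map X) t
  have he : Measurable (fun p : (Fin n → ℝ) × (Fin n → ℝ) => ee t p.1 p.2) := by unfold ee; fun_prop
  set γ : Measure (Fin n → ℝ) := Measure.pi fun _ : Fin n => gaussianReal 0 1 with hγ
  have hr : Measurable (fun p : (Fin n → ℝ) × (Fin n → ℝ) =>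
      ENNReal.ofReal (ee t p.1 p.2 / MM (μ.map X) (fun _ => 1) t p.2)) :=
    (he.div (hL.comp measurable_snd)).ennreal_ofReal
  have hPQ : (μ.map X).prod (μ.map (YY X N t)) = ((μ.map X).prod γ).withDensity
      (fun p => ENNReal.ofReal (MM (μ.map X) (fun _ => 1) t p.2)) := by
    have : SFinite (γ.withDensity fun y => ENNReal.ofReal (MM (μ.map X) (fun _ => 1) t y)) := by
      rw [← hY]; infer_instance
    rw [hY, prod_withDensity_right hL.ennreal_ofReal]
  have hJPQ : μ.map (fun ω => (X ω, YY X N t ω)) = ((μ.map X).prod (μ.map (YY X N t))).withDensity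
      (fun p => ENNReal.ofReal (ee t p.1 p.2 / MM (μ.map X) (fun _ => 1) t p.2)) := by
    have hL2 : Measurable (fun p : (Fin n → ℝ) × (Fin n → ℝ) =>
        ENNReal.ofReal (MM (μ.map X) (fun _ => 1) t p.2)) := (hL.comp measurable_snd).ennreal_ofReal
    rw [hPQ, ← withDensity_mul _ hL2 hr, hJ]
    congr 1
    ext p
    simp only [Pi.mul_apply]
    have hp := LL_pos (μ.map X) t p.2
    rw [← ENNReal.ofReal_mul hp.le, mul_div_cancel₀ _ hp.ne']
  have hac : μ.map (fun ω => (X ω, YY X N t ω)) ≪ (μ.map X).prod (μ.map (YY X N t)) := by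
    rw [hJPQ]; exact withDensity_absolutelyContinuous _ _
  have hrn := Measure.rnDeriv_withDensity ((μ.map X).prod (μ.map (YY X N t))) hr
  rw [← hJPQ] at hrn
  have hllr : llr (μ.map (fun ω => (X ω, YY X N t ω))) ((μ.map X).prod (μ.map (YY X N t)))
      =ᵐ[μ.map (fun ω => (X ω, YY X N t ω))]
      fun p => (∑ i, (t * p.1 i * p.2 i - (t * p.1 i) ^ 2 / 2)) - Real.log (MM (μ.map X) (fun _ => 1) t p.2) := by
    filter_upwards [hac.ae_le hrn] with p hp
    have hLp := LL_pos (μ.map X) t p.2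
    rw [llr, hp, ENNReal.toReal_ofReal (div_nonneg (ee_pos _ _ _).le hLp.le),
      Real.log_div (ee_pos _ _ _).ne' hLp.ne', ee, Real.log_exp]
  obtain ⟨hli, hle⟩ := logLL_facts hX hN hXN hN_law hX2 ht
  have j1 : ∀ i, Integrable (fun ω => X ω i * N ω i) μ := fun i =>
    (memLp_X hX hX2 i).integrable_mul (N_sq_integrable hN hN_law i)
  have j2 : ∀ i, Integrable (fun ω => X ω i ^ 2) μ := fun i => (memLp_X hX hX2 i).integrable_sq
  have eS : ∀ ω, ∑ i, (t * X ω i * YY X N t ω i - (t * X ω i) ^ 2 / 2) =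
      ∑ i, (t ^ 2 / 2 * X ω i ^ 2 + t * (X ω i * N ω i)) := fun ω => by
    refine Finset.sum_congr rfl fun i _ => ?_
    simp only [YY]; ring
  have iS : Integrable (fun ω => ∑ i, (t * X ω i * YY X N t ω i - (t * X ω i) ^ 2 / 2)) μ := by
    simp only [eS]
    exact integrable_finsetSum _ fun i _ => ((j2 i).const_mul _).add ((j1 i).const_mul _)
  have vS : ∫ ω, ∑ i, (t * X ω i * YY X N t ω i - (t * X ω i) ^ 2 / 2) ∂μ =
      t ^ 2 / 2 * (∑ i, ∫ ω, X ω i ^ 2 ∂μ) := by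
    simp only [eS]
    rw [integral_finsetSum, Finset.mul_sum]
    · refine Finset.sum_congr rfl fun i _ => ?_
      rw [integral_add ((j2 i).const_mul _) ((j1 i).const_mul _), integral_const_mul, integral_const_mul,
        XN_mean hX hN hXN hN_law i, mul_zero, add_zero]
    · exact fun i _ => ((j2 i).const_mul _).add ((j1 i).const_mul _)
  have hmeas : Measurable (fun p : (Fin n → ℝ) × (Fin n → ℝ) =>
      (∑ i, (t * p.1 i * p.2 i - (t * p.1 i) ^ 2 / 2)) - Real.log (MM (μ.map X) (fun _ => 1) t p.2)) :=
    Measurable.sub (by fun_prop) (Real.measurable_log.comp (hL.comp measurable_snd))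
  have hint : Integrable (llr (μ.map (fun ω => (X ω, YY X N t ω))) ((μ.map X).prod (μ.map (YY X N t))))
      (μ.map (fun ω => (X ω, YY X N t ω))) := by
    rw [integrable_congr hllr, integrable_map_measure hmeas.aestronglyMeasurable hXY.aemeasurable]
    exact iS.sub hli
  have hnn := InformationTheory.integral_llr_add_sub_measure_univ_nonneg hac hint
  simp only [probReal_univ, add_sub_cancel_right] at hnn
  unfold mutualInfo klDiv
  rw [if_pos ⟨hac, hint⟩, ENNReal.toReal_ofReal hnn, integral_congr_ae hllr,
    integral_map hXY.aemeasurable hmeas.aestronglyMeasurable]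
  simp only
  rw [integral_sub iS hli, vS, hle]

end final

/-- **I-MMSE relation for the discrete-time Gaussian channel** (Corollary 3): with
`Σᵢ E[Xᵢ²] < ∞`, `d/dsnr I(Xⁿ; √snr·Xⁿ + Nⁿ) = (1/2) Σᵢ mmse(i, snr)`, where
`mmse(i, snr) = E[(Xᵢ − E[Xᵢ | Yⁿ; snr])²]` is the noncausal MMSE at time `i`. -/
theorem hasDerivAt_mutualInfo_discreteTime
    {Ω : Type*} [MeasurableSpace Ω] (μ : Measure Ω) [IsProbabilityMeasure μ]
    {n : ℕ} (X N : Ω → Fin n → ℝ)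
    (hX : Measurable X) (hN : Measurable N)
    (hXN : IndepFun X N μ)
    (hN_law : μ.map N = Measure.pi fun _ : Fin n => gaussianReal 0 1)
    (hX2 : Integrable (fun ω => ∑ i, X ω i ^ 2) μ) :
    ∀ snr ∈ Set.Ioi (0 : ℝ),
      HasDerivAt (fun s : ℝ => (mutualInfo μ X (chOutN X N s)).toReal)
        ((1 / 2) * ∑ i, ∫ ω, (X ω i -
            (μ[fun ω' => X ω' i |
                MeasurableSpace.comap (chOutN X N snr) inferInstance]) ω) ^ 2 ∂μ)
        snr := by
  intro snr hs
  have hs' : 0 < snr := hs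
  have hsq : 0 < √snr := Real.sqrt_pos.2 hs'
  have hch : ∀ s, chOutN X N s = YY X N (√s) := fun s => rfl
  simp_rw [hch]
  simp_rw [mmse_eq hX hN hXN hN_law hX2]
  set h : ℝ → ℝ := fun u => u * ∑ i, ∫ ω, KK (μ.map X) (fun x => x i) u (YY X N u ω) ^ 2 ∂μ with hh
  have hc : Continuous h :=
    continuous_id.mul (continuous_finsetSum _ fun i _ => H_continuous hX hN hXN hN_law hX2 i)
  set C : ℝ := ∑ i, ∫ ω, X ω i ^ 2 ∂μ with hC
  have d1 : HasDerivAt (fun t : ℝ => t ^ 2 / 2 * C - ∫ u in 0..t, h u)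
      (√snr * C - h (√snr)) (√snr) := by
    have a1 : HasDerivAt (fun t : ℝ => t ^ 2 / 2 * C) (√snr * C) (√snr) := by
      refine ((((hasDerivAt_id (√snr)).pow 2).div_const 2).mul_const C).congr_deriv ?_
      simp
    exact a1.sub (intervalIntegral.integral_hasDerivAt_right (hc.intervalIntegrable _ _)
      (hc.stronglyMeasurableAtFilter _ _) hc.continuousAt)
  have d2 := d1.comp snr (Real.hasDerivAt_sqrt hs'.ne')
  have hfun : (fun s : ℝ => (mutualInfo μ X (YY X N (√s))).toReal) =
      (fun t : ℝ => t ^ 2 / 2 * C - ∫ u in 0..t, h u) ∘ fun s => √s := by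
    funext s
    exact mutualInfo_formula hX hN hXN hN_law hX2 (Real.sqrt_nonneg s)
  rw [hfun]
  refine d2.congr_deriv ?_
  rw [Finset.sum_sub_distrib, ← hC, hh]
  simp only
  field_simp
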